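/- For every real number y, the limit lim_{n→∞} (1/n)·#{i : 1 ≤ i ≤ n, μ(i) < y} exists and equals F(y), where F(y) = 0 for y ≤ -1, F(y) = 3/π² for -1 < y ≤ 0, F(y) = 1 - 3/π² for 0 < y ≤ 1, and F(y) = 1 for y > 1. (Theorem 1: the empirical distribution functions of the Möbius function on {1,…,n} converge pointwise to the limiting distribution function F.) -/

import Mathlib

open Filter Real
open ArithmeticFunction (moebius)
open MeasureTheory FourierTransform Topology

theorem integral_fourier_mul_eq_flip {f g : ℝ → ℂ} (hf : Integrable f) (hg : Integrable g) :
    ∫ ξ, 𝓕 f ξ * g ξ = ∫ u, f u * 𝓕 g u := by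
  have h := VectorFourier.integral_fourierIntegral_smul_eq_flip (L := innerₗ ℝ) (μ := volume)
    (ν := volume) Real.continuous_fourierChar continuous_inner hf hg
  simp only [flip_innerₗ, smul_eq_mul] at h
  exact h

theorem fourier_fourierChar_smul (g : ℝ → ℂ) (x u : ℝ) :
    𝓕 (fun ξ => 𝐞 (x * ξ) • g ξ) u = 𝓕 g (u - x) := by
  simp only [Real.fourier_real_eq, smul_smul, ← AddChar.map_add_eq_mul]
  congr! 4
  ring

theorem integrable_exp_neg_mul_of_bounded {f : ℝ → ℂ} {C σ : ℝ}
    (hfm : AEStronglyMeasurable f) (hfb : ∀ u, ‖f u‖ ≤ C) (hf0 : ∀ u < 0, f u = 0) (hσ : 0 < σ) :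
    Integrable (fun u => (rexp (-σ * u) : ℂ) * f u) := by
  have hI : IntegrableOn (fun u => C * rexp (-σ * u)) (Set.Ici 0) :=
    ((integrableOn_Ici_iff_integrableOn_Ioi).2 (exp_neg_integrableOn_Ioi 0 hσ)).const_mul C
  have hI' : Integrable ((Set.Ici 0).indicator fun u => C * rexp (-σ * u)) :=
    (integrable_indicator_iff measurableSet_Ici).2 hI
  refine hI'.mono' (by fun_prop) (ae_of_all _ fun u => ?_)
  rcases lt_or_ge u 0 with hu | hu
  · simp [hf0 u hu, Set.indicator_of_notMem, hu]
  · rw [Set.indicator_of_mem (Set.mem_Ici.2 hu), norm_mul, Complex.norm_real,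
      Real.norm_of_nonneg (Real.exp_pos _).le, mul_comm C]
    exact mul_le_mul_of_nonneg_left (hfb u) (Real.exp_pos _).le

/-- If the Laplace transform of a bounded function `f` supported on `[0, ∞)` extends continuously
to the imaginary axis, then the averages of `f` against the translates of a kernel with compactly
supported Fourier transform are given by the boundary values of the Laplace transform. -/
theorem integral_mul_fourier_translate_eq {f : ℝ → ℂ} {C : ℝ} {H : ℝ → ℝ → ℂ} {ψ : ℝ → ℂ}
    (hfm : AEStronglyMeasurable f) (hfb : ∀ u, ‖f u‖ ≤ C) (hf0 : ∀ u < 0, f u = 0)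
    (hH : ContinuousOn H.uncurry (Set.Ici 0 ×ˢ Set.univ))
    (hfH : ∀ σ > 0, ∀ ξ, 𝓕 (fun u => (rexp (-σ * u) : ℂ) * f u) ξ = H σ ξ)
    (hψ : Continuous ψ) (hψc : HasCompactSupport ψ) (hψi : Integrable (𝓕 ψ)) (x : ℝ) :
    ∫ u, f u * 𝓕 ψ (u - x) = 𝓕 (fun ξ => H 0 ξ * ψ ξ) (-x) := by
  have hint : Integrable (fun u => 𝓕 ψ (u - x)) := hψi.comp_sub_right x
  have hleft : Tendsto (fun σ : ℝ => ∫ u, (rexp (-σ * u) : ℂ) * f u * 𝓕 ψ (u - x)) (𝓝[>] 0)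
      (𝓝 (∫ u, f u * 𝓕 ψ (u - x))) := by
    refine tendsto_integral_filter_of_dominated_convergence (fun u => C * ‖𝓕 ψ (u - x)‖)
      (Eventually.of_forall fun σ => ?_) ?_ (hint.norm.const_mul C) (ae_of_all _ fun u => ?_)
    · exact (AEStronglyMeasurable.mul (by fun_prop) hfm).mul hint.aestronglyMeasurable
    · filter_upwards [self_mem_nhdsWithin] with σ hσ
      refine ae_of_all _ fun u => ?_
      rw [norm_mul]
      refine mul_le_mul_of_nonneg_right ?_ (norm_nonneg _)
      rcases lt_or_ge u 0 with hu | hu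
      · simpa [hf0 u hu] using (norm_nonneg _).trans (hfb 0)
      · rw [norm_mul, Complex.norm_real, Real.norm_of_nonneg (Real.exp_pos _).le]
        refine (mul_le_of_le_one_left (norm_nonneg _) (Real.exp_le_one_iff.2 ?_)).trans (hfb u)
        have : 0 ≤ σ * u := mul_nonneg (le_of_lt hσ) hu
        linarith
    · have : Continuous fun σ : ℝ => (rexp (-σ * u) : ℂ) * f u * 𝓕 ψ (u - x) := by fun_prop
      simpa using (this.tendsto 0).mono_left nhdsWithin_le_nhds
  have hright : Tendsto (fun σ : ℝ => ∫ ξ, H σ ξ * 𝐞 (x * ξ) • ψ ξ) (𝓝[>] 0)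
      (𝓝 (∫ ξ, H 0 ξ * 𝐞 (x * ξ) • ψ ξ)) := by
    have hcont : ContinuousOn (fun σ : ℝ => ∫ ξ, H σ ξ * 𝐞 (x * ξ) • ψ ξ) (Set.Ici 0) := by
      refine continuousOn_integral_of_compact_support hψc.isCompact ?_ ?_
      · refine hH.mul (Continuous.continuousOn ?_)
        have := Real.continuous_fourierChar
        fun_prop
      · intro σ ξ _ hξ
        simp [image_eq_zero_of_notMem_tsupport hξ]
    exact (hcont 0 (by simp)).mono_left (nhdsWithin_mono _ Set.Ioi_subset_Ici_self)
  have hψ' : Integrable (fun ξ => 𝐞 (x * ξ) • ψ ξ) := by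
    have := Real.continuous_fourierChar
    exact Continuous.integrable_of_hasCompactSupport (by fun_prop)
      (hψc.mono fun ξ h h0 => h (by simp [h0]))
  have heq : ∀ σ > 0, ∫ u, (rexp (-σ * u) : ℂ) * f u * 𝓕 ψ (u - x) =
      ∫ ξ, H σ ξ * 𝐞 (x * ξ) • ψ ξ := by
    intro σ hσ
    simp_rw [← hfH σ hσ, ← fourier_fourierChar_smul ψ x]
    exact (integral_fourier_mul_eq_flip
      (integrable_exp_neg_mul_of_bounded hfm hfb hf0 hσ) hψ').symm
  rw [tendsto_nhds_unique hleft (hright.congr' ?_), Real.fourier_real_eq]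
  · congr! 2 with ξ
    simp only [neg_neg, mul_neg, Circle.smul_def, smul_eq_mul, mul_comm ξ x]
    ring
  · filter_upwards [self_mem_nhdsWithin] with σ hσ using (heq σ hσ).symm

theorem exists_fourier_approx_identity {ε : ℝ} (hε : 0 < ε) :
    ∃ ψ : ℝ → ℂ, Continuous ψ ∧ HasCompactSupport ψ ∧ Integrable (𝓕 ψ) ∧
      Integrable (fun u => |u| * ‖𝓕 ψ u‖) ∧ ∫ u, 𝓕 ψ u = 1 ∧ ∫ u, |u| * ‖𝓕 ψ u‖ ≤ ε := by
  let b : ContDiffBump (0 : ℝ) := ⟨1, 2, one_pos, one_lt_two⟩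
  have hbc : HasCompactSupport (fun x => (b x : ℂ)) :=
    b.hasCompactSupport.comp_left (g := Complex.ofReal) Complex.ofReal_zero
  have hbd : ContDiff ℝ (⊤ : ℕ∞) (fun x => (b x : ℂ)) := Complex.ofRealCLM.contDiff.comp b.contDiff
  let η : SchwartzMap ℝ ℂ := hbc.toSchwartzMap hbd
  have hη0 : η 0 = 1 := by
    change ((b 0 : ℝ) : ℂ) = 1
    rw [b.one_of_mem_closedBall (by simp [b]), Complex.ofReal_one]
  set φ : SchwartzMap ℝ ℂ := 𝓕 η
  have hφ : (𝓕 (η : ℝ → ℂ) : ℝ → ℂ) = φ := (SchwartzMap.fourier_coe η).symm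
  have hφ1 : ∫ u, φ u = 1 := by
    have h := congrFun (η.continuous.fourierInv_fourier_eq η.integrable
      (by rw [hφ]; exact φ.integrable)) 0
    rw [hφ, hη0, Real.fourierInv_eq'] at h
    simpa using h
  have hφm : Integrable (fun u => |u| * ‖φ u‖) := by
    simpa using φ.integrable_pow_mul volume 1
  set K := ∫ u, |u| * ‖φ u‖
  have hK : 0 ≤ K := integral_nonneg fun u => by positivity
  set r : ℝ := (K + 1) / ε
  have hr : 0 < r := by positivity
  have hscale : ∀ u, 𝓕 (fun ξ => η (ξ / r)) u = r * φ (r * u) := by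
    intro u
    rw [← hφ, Real.fourier_real_eq, Real.fourier_real_eq]
    have h := Measure.integral_comp_div (fun v : ℝ => 𝐞 (-(v * (r * u))) • η v) r
    rw [abs_of_pos hr, Complex.real_smul] at h
    rw [← h]
    congr! 4 with v
    field_simp
  refine ⟨fun ξ => η (ξ / r), by fun_prop, ?_, ?_, ?_, ?_, ?_⟩
  · have := hbc.comp_homeomorph (Homeomorph.mulRight₀ r⁻¹ (by positivity))
    simp_rw [div_eq_mul_inv]
    exact this
  · simp_rw [funext hscale]
    exact (φ.integrable.comp_mul_left' hr.ne').const_mul _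
  · have h := hφm.comp_mul_left' hr.ne'
    refine h.congr (ae_of_all _ fun u => ?_)
    simp [hscale, abs_of_pos hr, abs_mul]
    ring
  · simp_rw [hscale]
    rw [integral_const_mul, Measure.integral_comp_mul_left (fun v => φ v), hφ1,
      abs_of_pos (inv_pos.2 hr)]
    simp [hr.ne']
  · have h : ∀ u, |u| * ‖𝓕 (fun ξ => η (ξ / r)) u‖ = |r * u| * ‖φ (r * u)‖ := by
      intro u
      simp [hscale, abs_of_pos hr, abs_mul]
      ring
    simp_rw [h]
    rw [Measure.integral_comp_mul_left (fun v => |v| * ‖φ v‖), abs_of_pos (inv_pos.2 hr),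
      smul_eq_mul]
    change r⁻¹ * K ≤ ε
    rw [inv_mul_le_iff₀ hr, div_mul_cancel₀ _ hε.ne']
    linarith

/-- A Tauberian theorem: a bounded, slowly oscillating function supported on `[0, ∞)` whose Laplace
transform extends continuously to the imaginary axis tends to zero. -/
theorem tendsto_zero_of_continuousOn_laplace {f : ℝ → ℂ} {C D : ℝ} {H : ℝ → ℝ → ℂ}
    (hfm : AEStronglyMeasurable f) (hfb : ∀ u, ‖f u‖ ≤ C) (hf0 : ∀ u < 0, f u = 0)
    (hD : 0 ≤ D) (hfs : ∀ u v, ‖f u - f v‖ ≤ D * |u - v| + rexp (-v))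
    (hH : ContinuousOn H.uncurry (Set.Ici 0 ×ˢ Set.univ))
    (hfH : ∀ σ > 0, ∀ ξ, 𝓕 (fun u => (rexp (-σ * u) : ℂ) * f u) ξ = H σ ξ) :
    Tendsto f atTop (𝓝 0) := by
  rw [Metric.tendsto_nhds]
  intro ε hε
  obtain ⟨ψ, hψ, hψc, hψi, hψm, hψ1, hψε⟩ :=
    exists_fourier_approx_identity (ε := ε / (2 * (D + 1))) (by positivity)
  have hlim : Tendsto (fun x => ‖∫ u, f u * 𝓕 ψ (u - x)‖ + rexp (-x) * ∫ u, ‖𝓕 ψ u‖) atTop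
      (𝓝 0) := by
    have h1 : Tendsto (fun x => ∫ u, f u * 𝓕 ψ (u - x)) atTop (𝓝 0) := by
      simp_rw [integral_mul_fourier_translate_eq hfm hfb hf0 hH hfH hψ hψc hψi]
      exact (Real.zero_at_infty_fourier _).comp
        (tendsto_neg_atTop_atBot.mono_right atBot_le_cocompact)
    simpa using h1.norm.add (Real.tendsto_exp_neg_atTop_nhds_zero.mul_const (∫ u, ‖𝓕 ψ u‖))
  filter_upwards [hlim.eventually_lt_const (half_pos hε)] with x hx
  rw [dist_zero_right]
  have hshift : ∫ u, f u * 𝓕 ψ (u - x) = ∫ u, f (u + x) * 𝓕 ψ u := by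
    rw [← integral_add_right_eq_self _ x]
    simp
  have hfx : AEStronglyMeasurable (fun u => f (u + x)) :=
    hfm.comp_quasiMeasurePreserving (quasiMeasurePreserving_add_right volume x)
  have hi1 : Integrable (fun u => f (u + x) * 𝓕 ψ u) :=
    hψi.bdd_mul hfx (ae_of_all _ fun u => hfb (u + x))
  have hi2 : Integrable (fun u => f x * 𝓕 ψ u) := hψi.const_mul _
  have hdiff : ‖(∫ u, f u * 𝓕 ψ (u - x)) - f x‖ ≤
      D * (∫ u, |u| * ‖𝓕 ψ u‖) + rexp (-x) * ∫ u, ‖𝓕 ψ u‖ := by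
    have hfx1 : f x = ∫ u, f x * 𝓕 ψ u := by rw [integral_const_mul, hψ1, mul_one]
    rw [hshift]
    rw [hfx1, ← integral_sub hi1 hi2, ← integral_const_mul, ← integral_const_mul,
      ← integral_add (hψm.const_mul _) (hψi.norm.const_mul _)]
    refine norm_integral_le_of_norm_le ((hψm.const_mul _).add (hψi.norm.const_mul _))
      (ae_of_all _ fun u => ?_)
    rw [← sub_mul, norm_mul, ← mul_assoc, ← add_mul]
    refine mul_le_mul_of_nonneg_right ((hfs (u + x) x).trans ?_) (norm_nonneg _)
    rw [add_sub_cancel_right]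
  have hsmall : D * (∫ u, |u| * ‖𝓕 ψ u‖) ≤ ε / 2 := by
    refine (mul_le_mul_of_nonneg_left hψε hD).trans ?_
    rw [mul_div_assoc', div_le_div_iff₀ (by positivity) two_pos]
    nlinarith
  have := norm_sub_norm_le (f x) (∫ u, f u * 𝓕 ψ (u - x))
  rw [norm_sub_rev] at this
  linarith

/-- The Mertens function `M(n) = ∑ k ≤ n, μ(k)`. -/
noncomputable def mertens (n : ℕ) : ℝ := ∑ k ∈ Finset.Icc 1 n, (moebius k : ℝ)

theorem abs_moebius_cast_le_one (k : ℕ) : |(moebius k : ℝ)| ≤ 1 := by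
  exact_mod_cast ArithmeticFunction.abs_moebius_le_one (n := k)

theorem abs_mertens_sub_le {m n : ℕ} (h : m ≤ n) : |mertens n - mertens m| ≤ n - m := by
  have h1 : mertens n - mertens m = ∑ k ∈ Finset.Ioc m n, (moebius k : ℝ) := by
    rw [mertens, mertens, sub_eq_iff_eq_add, add_comm]
    exact (Finset.sum_Ioc_consecutive (fun k => (moebius k : ℝ)) m.zero_le h).symm
  rw [h1, ← Nat.cast_sub h, ← Nat.card_Ioc]
  refine (Finset.abs_sum_le_sum_abs _ _).trans ?_
  simpa using Finset.sum_le_sum fun k (_ : k ∈ Finset.Ioc m n) => abs_moebius_cast_le_one k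

theorem abs_mertens_le (n : ℕ) : |mertens n| ≤ n := by
  simpa [mertens] using abs_mertens_sub_le n.zero_le

/-- The function `u ↦ M(e ^ u) e ^ (-u)`. -/
noncomputable def scaledMertens (u : ℝ) : ℝ := mertens ⌊rexp u⌋₊ * rexp (-u)

theorem measurable_scaledMertens : Measurable scaledMertens :=
  ((measurable_from_nat (f := mertens)).comp (Nat.measurable_floor.comp measurable_exp)).mul
    (by fun_prop)

theorem abs_scaledMertens_le_one (u : ℝ) : |scaledMertens u| ≤ 1 := by
  rw [scaledMertens, abs_mul, abs_of_pos (exp_pos (-u)), exp_neg, ← div_eq_mul_inv,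
    div_le_one (exp_pos u)]
  exact (abs_mertens_le _).trans (Nat.floor_le (exp_pos u).le)

theorem scaledMertens_of_neg {u : ℝ} (hu : u < 0) : scaledMertens u = 0 := by
  rw [scaledMertens, Nat.floor_eq_zero.2 (by simpa using hu)]
  simp [mertens]

theorem abs_scaledMertens_sub_le_of_le {u v : ℝ} (h : u ≤ v) :
    |scaledMertens v - scaledMertens u| ≤ 2 * (v - u) + rexp (-v) := by
  have hexp : 1 - rexp (u - v) ≤ v - u := by linarith [add_one_le_exp (u - v)]
  have hle : rexp u ≤ rexp v := exp_le_exp.2 h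
  have hM : |mertens ⌊rexp v⌋₊ - mertens ⌊rexp u⌋₊| ≤ rexp v - rexp u + 1 := by
    refine (abs_mertens_sub_le (Nat.floor_mono hle)).trans ?_
    linarith [Nat.floor_le (exp_pos v).le, Nat.lt_floor_add_one (rexp u)]
  have hsplit : scaledMertens v - scaledMertens u =
      (mertens ⌊rexp v⌋₊ - mertens ⌊rexp u⌋₊) * rexp (-v) +
        scaledMertens u * (rexp (u - v) - 1) := by
    have : rexp (-u) * rexp (u - v) = rexp (-v) := by rw [← exp_add]; congr 1; ring
    rw [scaledMertens, scaledMertens, ← this]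
    ring
  have h1 : |(mertens ⌊rexp v⌋₊ - mertens ⌊rexp u⌋₊) * rexp (-v)| ≤
      (1 - rexp (u - v)) + rexp (-v) := by
    rw [abs_mul, abs_of_pos (exp_pos (-v))]
    refine (mul_le_mul_of_nonneg_right hM (exp_pos _).le).trans_eq ?_
    rw [sub_eq_add_neg u v, exp_add u, add_mul, sub_mul, ← exp_add v]
    simp
  have h2 : |scaledMertens u * (rexp (u - v) - 1)| ≤ 1 - rexp (u - v) := by
    rw [abs_mul, abs_sub_comm, abs_of_nonneg (sub_nonneg.2 (exp_le_one_iff.2 (by linarith)))]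
    exact mul_le_of_le_one_left (sub_nonneg.2 (exp_le_one_iff.2 (by linarith)))
      (abs_scaledMertens_le_one u)
  rw [hsplit]
  linarith [abs_add_le ((mertens ⌊rexp v⌋₊ - mertens ⌊rexp u⌋₊) * rexp (-v))
    (scaledMertens u * (rexp (u - v) - 1))]

theorem abs_scaledMertens_sub_le (u v : ℝ) :
    |scaledMertens u - scaledMertens v| ≤ 2 * |u - v| + rexp (-v) := by
  rcases le_total u v with h | h
  · rw [abs_sub_comm, abs_sub_comm u, abs_of_nonneg (sub_nonneg.2 h)]
    exact abs_scaledMertens_sub_le_of_le h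
  · rw [abs_of_nonneg (sub_nonneg.2 h)]
    have : rexp (-u) ≤ rexp (-v) := exp_le_exp.2 (by linarith)
    linarith [abs_scaledMertens_sub_le_of_le h]

/-- The function `s ↦ 1 / (s ζ(s))`, extended continuously to `s = 1`. -/
noncomputable def invMulZeta : ℂ → ℂ :=
  Function.update (fun s => (s * riemannZeta s)⁻¹) 1 0

theorem continuousOn_invMulZeta : ContinuousOn invMulZeta {s | 1 ≤ s.re} := by
  intro s hs
  refine ContinuousAt.continuousWithinAt ?_
  rcases eq_or_ne s 1 with rfl | h1
  · rw [invMulZeta, continuousAt_update_same]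
    have h : Tendsto (fun s : ℂ => (s - 1) * (s * ((s - 1) * riemannZeta s))⁻¹) (𝓝[≠] 1)
        (𝓝 ((1 - 1) * (1 * 1)⁻¹)) := by
      have hid : Tendsto (fun s : ℂ => s) (𝓝[≠] 1) (𝓝 1) := tendsto_id'.2 nhdsWithin_le_nhds
      exact (hid.sub_const 1).mul ((hid.mul riemannZeta_residue_one).inv₀ (by simp))
    rw [sub_self, zero_mul] at h
    refine h.congr' ?_
    filter_upwards [self_mem_nhdsWithin] with s hs
    have : s - 1 ≠ 0 := sub_ne_zero.2 hs
    simp only [mul_inv]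
    field_simp
  · rw [invMulZeta, continuousAt_update_of_ne h1]
    have hs0 : s ≠ 0 := by
      rintro rfl
      norm_num at hs
    exact (continuousAt_id.mul (differentiableAt_riemannZeta h1).continuousAt).inv₀
      (mul_ne_zero hs0 (riemannZeta_ne_zero_of_one_le_re hs))

theorem integral_mertens_mul_cpow {s : ℂ} (hs : 1 < s.re) :
    ∫ t in Set.Ioi (1 : ℝ), (mertens ⌊t⌋₊ : ℂ) * (t : ℂ) ^ (-(s + 1)) = invMulZeta s := by
  have hs1 : s ≠ 1 := by
    rintro rfl
    norm_num at hs
  have hs0 : s ≠ 0 := by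
    rintro rfl
    norm_num at hs
  have hL := LSeries_eq_mul_integral' (fun n => (moebius n : ℂ)) zero_le_one hs (by
    refine Asymptotics.isBigO_of_le _ fun n => ?_
    rw [Real.norm_of_nonneg (Finset.sum_nonneg fun _ _ => norm_nonneg _), Real.rpow_one,
      Real.norm_of_nonneg n.cast_nonneg]
    calc ∑ k ∈ Finset.Icc 1 n, ‖(moebius k : ℂ)‖ ≤ ∑ k ∈ Finset.Icc 1 n, (1 : ℝ) :=
          Finset.sum_le_sum fun k _ => by
            rw [Complex.norm_intCast]
            exact abs_moebius_cast_le_one k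
      _ = n := by simp)
  have hζ := LSeries_one_mul_Lseries_moebius hs
  rw [LSeries_one_eq_riemannZeta hs, hL] at hζ
  have hcast : ∀ t : ℝ, (mertens ⌊t⌋₊ : ℂ) = ∑ k ∈ Finset.Icc 1 ⌊t⌋₊, (moebius k : ℂ) := by
    intro t
    simp [mertens]
  simp_rw [hcast]
  rw [invMulZeta, Function.update_of_ne hs1]
  exact eq_inv_of_mul_eq_one_right (by rw [mul_comm s, mul_assoc, hζ])

theorem fourier_exp_mul_scaledMertens {σ : ℝ} (hσ : 0 < σ) (ξ : ℝ) :
    𝓕 (fun u => (rexp (-σ * u) : ℂ) * (scaledMertens u : ℂ)) ξ =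
      invMulZeta (1 + σ + 2 * π * ξ * Complex.I) := by
  set s : ℂ := 1 + σ + 2 * π * ξ * Complex.I with hs
  have hre : 1 < s.re := by simpa [hs] using hσ
  rw [← integral_mertens_mul_cpow hre]
  have h := integral_comp_exp_Ioi (fun t : ℝ => (mertens ⌊t⌋₊ : ℂ) * (t : ℂ) ^ (-(s + 1))) 0
  rw [exp_zero] at h
  rw [← h, ← integral_Ici_eq_integral_Ioi, Real.fourier_real_eq_integral_exp_smul,
    ← integral_indicator measurableSet_Ici]
  congr 1
  ext u
  rcases lt_or_ge u 0 with hu | hu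
  · rw [Set.indicator_of_notMem (by simpa using hu), scaledMertens_of_neg hu]
    simp
  · rw [Set.indicator_of_mem (Set.mem_Ici.2 hu), Complex.cpow_def_of_ne_zero
      (by exact_mod_cast (exp_pos u).ne'), ← Complex.ofReal_log (exp_pos u).le, log_exp,
      scaledMertens, Complex.real_smul, smul_eq_mul]
    push_cast
    have : Complex.exp (u * -(s + 1)) * Complex.exp u =
        Complex.exp (-2 * π * u * ξ * Complex.I) * Complex.exp (-σ * u) * Complex.exp (-u) := by
      simp only [← Complex.exp_add]
      congr 1
      rw [hs]
      ring
    linear_combination (-(mertens ⌊rexp u⌋₊ : ℂ)) * this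

theorem tendsto_scaledMertens : Tendsto scaledMertens atTop (𝓝 0) := by
  have hline : Continuous fun p : ℝ × ℝ => (1 + p.1 + 2 * π * p.2 * Complex.I : ℂ) := by fun_prop
  have h := tendsto_zero_of_continuousOn_laplace (f := fun u => (scaledMertens u : ℂ)) (C := 1)
    (D := 2) (H := fun σ ξ => invMulZeta (1 + σ + 2 * π * ξ * Complex.I))
    (Complex.measurable_ofReal.comp measurable_scaledMertens).aestronglyMeasurable
    (fun u => by simpa using abs_scaledMertens_le_one u)
    (fun u hu => by simp [scaledMertens_of_neg hu]) zero_le_two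
    (fun u v => by
      rw [← Complex.ofReal_sub, Complex.norm_real]
      exact abs_scaledMertens_sub_le u v)
    (continuousOn_invMulZeta.comp hline.continuousOn fun p hp => by simpa using hp.1)
    (fun σ hσ ξ => fourier_exp_mul_scaledMertens hσ ξ)
  exact (Complex.continuous_re.tendsto 0).comp h

theorem tendsto_mertens_div : Tendsto (fun n : ℕ => mertens n / n) atTop (𝓝 0) := by
  refine (tendsto_scaledMertens.comp
    (tendsto_log_atTop.comp tendsto_natCast_atTop_atTop)).congr' ?_
  filter_upwards [eventually_gt_atTop 0] with n hn
  have hn' : (0 : ℝ) < n := Nat.cast_pos.2 hn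
  simp [scaledMertens, exp_neg, exp_log hn', div_eq_mul_inv]

theorem Squarefree.sq_dvd_sq_mul_iff {a : ℕ} (ha : Squarefree a) {b d : ℕ} (hb : 0 < b) :
    d ^ 2 ∣ b ^ 2 * a ↔ d ∣ b := by
  refine ⟨fun h => ?_, fun h => (pow_dvd_pow_of_dvd h 2).mul_right a⟩
  obtain ⟨g, d', b', hg, hcop, rfl, rfl⟩ := Nat.exists_coprime' (Nat.gcd_pos_of_pos_right d hb)
  rw [mul_pow, mul_pow, mul_right_comm, Nat.mul_dvd_mul_iff_right (by positivity)] at h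
  have hd : d' * d' ∣ a := by
    rw [← sq]
    exact (Nat.Coprime.pow 2 2 hcop).dvd_of_dvd_mul_left h
  rw [Nat.isUnit_iff.1 (ha d' hd), one_mul]
  exact dvd_mul_left _ _

theorem sum_moebius_of_sq_dvd {k n : ℕ} (hk : 0 < k) (hkn : k ≤ n) :
    ∑ d ∈ Finset.Icc 1 n with d ^ 2 ∣ k, moebius d = if Squarefree k then 1 else 0 := by
  obtain ⟨a, b, ha, hb, rfl, hsq⟩ := Nat.sq_mul_squarefree_of_pos hk
  have hfilter : {d ∈ Finset.Icc 1 n | d ^ 2 ∣ b ^ 2 * a} = b.divisors := by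
    ext d
    rw [Finset.mem_filter, hsq.sq_dvd_sq_mul_iff hb, Nat.mem_divisors, Finset.mem_Icc]
    refine ⟨fun h => ⟨h.2, hb.ne'⟩, fun h => ⟨⟨Nat.pos_of_dvd_of_pos h.1 hb, ?_⟩, h.1⟩⟩
    calc d ≤ b := Nat.le_of_dvd hb h.1
      _ ≤ b ^ 2 * a := by nlinarith [Nat.mul_le_mul hb ha]
      _ ≤ n := hkn
  have hiff : Squarefree (b ^ 2 * a) ↔ b = 1 := by
    refine ⟨fun h => Nat.isUnit_iff.1 (h b (by rw [← sq]; exact dvd_mul_right _ _)), ?_⟩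
    rintro rfl
    simpa using hsq
  rw [hfilter, ← ArithmeticFunction.coe_zeta_mul_apply, ArithmeticFunction.coe_zeta_mul_moebius,
    ArithmeticFunction.one_apply]
  simp only [hiff]

theorem card_squarefree_eq_sum (n : ℕ) :
    (((Finset.Icc 1 n).filter Squarefree).card : ℤ) =
      ∑ d ∈ Finset.Icc 1 n, moebius d * (n / d ^ 2 : ℕ) := by
  calc (((Finset.Icc 1 n).filter Squarefree).card : ℤ)
      = ∑ k ∈ Finset.Icc 1 n, ∑ d ∈ Finset.Icc 1 n with d ^ 2 ∣ k, moebius d := by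
        rw [Finset.card_filter]
        push_cast
        refine Finset.sum_congr rfl fun k hk => ?_
        rw [Finset.mem_Icc] at hk
        exact (sum_moebius_of_sq_dvd hk.1 hk.2).symm
    _ = ∑ d ∈ Finset.Icc 1 n, ∑ k ∈ Finset.Icc 1 n with d ^ 2 ∣ k, moebius d := by
        simp_rw [Finset.sum_filter]
        exact Finset.sum_comm
    _ = _ := by
        refine Finset.sum_congr rfl fun d _ => ?_
        have h : (Finset.Icc 1 n).filter (d ^ 2 ∣ ·) = (Finset.Ioc 0 n).filter (d ^ 2 ∣ ·) := rfl
        rw [Finset.sum_const, h, Nat.Ioc_filter_dvd_card_eq_div, nsmul_eq_mul, mul_comm]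

theorem tsum_moebius_div_sq : ∑' d : ℕ, (moebius d : ℝ) * ((d : ℝ) ^ 2)⁻¹ = 6 / π ^ 2 := by
  have h := LSeries_one_mul_Lseries_moebius (s := 2) (by norm_num)
  rw [LSeries_one_eq_riemannZeta (by norm_num), riemannZeta_two] at h
  have hL : LSeries (fun n => (moebius n : ℂ)) 2 =
      ((∑' d : ℕ, (moebius d : ℝ) * ((d : ℝ) ^ 2)⁻¹ : ℝ) : ℂ) := by
    rw [LSeries, Complex.ofReal_tsum]
    refine tsum_congr fun d => ?_
    rcases eq_or_ne d 0 with rfl | hd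
    · simp
    · rw [LSeries.term_of_ne_zero hd]
      push_cast
      rw [div_eq_mul_inv]
      norm_cast
  rw [hL] at h
  have h' : π ^ 2 / 6 * ∑' d : ℕ, (moebius d : ℝ) * ((d : ℝ) ^ 2)⁻¹ = 1 := by exact_mod_cast h
  have := pi_pos
  field_simp at h' ⊢
  linarith

theorem tendsto_natDiv_div (m : ℕ) :
    Tendsto (fun n : ℕ => ((n / m : ℕ) : ℝ) / n) atTop (𝓝 (m : ℝ)⁻¹) := by
  have h := (tendsto_nat_floor_mul_div_atTop (R := ℝ) (a := (m : ℝ)⁻¹) (by positivity)).comp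
    tendsto_natCast_atTop_atTop
  refine h.congr fun n => ?_
  simp only [Function.comp_apply]
  rw [inv_mul_eq_div, Nat.floor_div_natCast, Nat.floor_natCast]

/-- The natural density of the squarefree numbers is `6 / π ^ 2`. -/
theorem tendsto_card_squarefree_div :
    Tendsto (fun n : ℕ => (((Finset.Icc 1 n).filter Squarefree).card : ℝ) / n) atTop
      (𝓝 (6 / π ^ 2)) := by
  have hsum : ∀ n : ℕ, (((Finset.Icc 1 n).filter Squarefree).card : ℝ) / n =
      ∑' d : ℕ, (moebius d : ℝ) * (((n / d ^ 2 : ℕ) : ℝ) / n) := by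
    intro n
    rw [tsum_eq_sum (s := Finset.Icc 1 n)]
    · have h : (((Finset.Icc 1 n).filter Squarefree).card : ℝ) =
          ∑ d ∈ Finset.Icc 1 n, (moebius d : ℝ) * (n / d ^ 2 : ℕ) := by
        have := congrArg (Int.cast : ℤ → ℝ) (card_squarefree_eq_sum n)
        push_cast at this
        exact this
      rw [h, Finset.sum_div]
      simp_rw [mul_div_assoc]
    · intro d hd
      rcases eq_or_ne d 0 with rfl | hd0
      · simp
      · have hlt : n < d ^ 2 := by
          have hnd : n < d := by
            by_contra! h
            exact hd (Finset.mem_Icc.2 ⟨Nat.pos_of_ne_zero hd0, h⟩)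
          nlinarith
        simp [Nat.div_eq_of_lt hlt]
  simp_rw [hsum]
  rw [← tsum_moebius_div_sq]
  refine tendsto_tsum_of_dominated_convergence (bound := fun d : ℕ => ((d : ℝ) ^ 2)⁻¹)
    (Real.summable_nat_pow_inv.2 one_lt_two) (fun d => ?_) (Eventually.of_forall fun n d => ?_)
  · rw [← Nat.cast_pow]
    exact (tendsto_natDiv_div (d ^ 2)).const_mul (moebius d : ℝ)
  · rw [norm_mul, Real.norm_eq_abs, Real.norm_of_nonneg (by positivity)]
    refine (mul_le_of_le_one_left (by positivity) (abs_moebius_cast_le_one d)).trans ?_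
    rcases Nat.eq_zero_or_pos n with rfl | hn
    · simp
    · rw [div_le_iff₀ (by positivity), inv_mul_eq_div]
      exact_mod_cast Nat.cast_div_le (α := ℝ) (m := n) (n := d ^ 2)

theorem card_filter_moebius_lt (y : ℝ) (n : ℕ) :
    (((Finset.Icc 1 n).filter (fun i => (moebius i : ℝ) < y)).card : ℝ) =
      if y ≤ -1 then 0
      else if y ≤ 0 then (((Finset.Icc 1 n).filter Squarefree).card - mertens n) / 2
      else if y ≤ 1 then n - (((Finset.Icc 1 n).filter Squarefree).card + mertens n) / 2
      else n := by
  have hn : (n : ℝ) = ∑ i ∈ Finset.Icc 1 n, (1 : ℝ) := by simp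
  simp only [Finset.card_filter, Nat.cast_sum, mertens]
  rw [hn, ← Finset.sum_sub_distrib, ← Finset.sum_add_distrib, Finset.sum_div, Finset.sum_div,
    ← Finset.sum_sub_distrib]
  split_ifs
  on_goal 1 => refine Finset.sum_eq_zero fun i _ => ?_
  on_goal 2 => refine Finset.sum_congr rfl fun i _ => ?_
  on_goal 3 => refine Finset.sum_congr rfl fun i _ => ?_
  on_goal 4 => refine Finset.sum_congr rfl fun i _ => ?_
  all_goals
    have hi := ArithmeticFunction.moebius_ne_zero_iff_squarefree (n := i)
    rcases ArithmeticFunction.moebius_eq_or i with h | h | h <;>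
      simp only [← hi, h] <;> norm_num <;> linarith

theorem moebius_limiting_distribution (y : ℝ) :
    Tendsto (fun n : ℕ =>
      (((Finset.Icc 1 n).filter (fun i => (ArithmeticFunction.moebius i : ℝ) < y)).card : ℝ) / n)
      atTop (nhds
        (if y ≤ -1 then 0
         else if y ≤ 0 then 3 / π ^ 2
         else if y ≤ 1 then 1 - 3 / π ^ 2
         else 1)) := by
  simp_rw [card_filter_moebius_lt y]
  have hself : Tendsto (fun n : ℕ => (n : ℝ) / n) atTop (𝓝 1) := by
    refine tendsto_const_nhds.congr' ?_
    filter_upwards [eventually_ne_atTop 0] with n hn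
    rw [div_self (Nat.cast_ne_zero.2 hn)]
  split_ifs
  · simp
  · convert (tendsto_card_squarefree_div.sub tendsto_mertens_div).div_const 2 using 2
    · ring
    · ring
  · convert hself.sub ((tendsto_card_squarefree_div.add tendsto_mertens_div).div_const 2) using 2
    · ring
    · ring
  · exact hself
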